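/- Let ζ ∈ ℂ satisfy ζ^5 = 1, and for x = (x1,x2,x3,x4) ∈ ℂ⁴ set g·x := (ζ·x1, ζ²·x2, ζ³·x3, ζ⁴·x4). Then for every a ∈ ℂ¹² and every x ∈ ℂ⁴, det M(a, g·x) = det M(a, x); that is, the quintic determinantal polynomial x ↦ det M(a,x) is invariant under the Godeaux action of ℤ/5ℤ. -/

import Mathlib

open Matrix

/-- The symmetric 5×5 matrix `M(a,x)` of the Campedelli quadratic form `q(a,x)`,
with parameters `a = (a1,…,a12)` (indexed `a 0,…,a 11`) and
`x = (x1,x2,x3,x4)` (indexed `x 0,…,x 3`). -/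
noncomputable def CampedelliM (a : Fin 12 → ℂ) (x : Fin 4 → ℂ) : Matrix (Fin 5) (Fin 5) ℂ :=
  !![a 0 * x 0, a 1 * x 1, a 2 * x 2, a 3 * x 3, 0;
     a 1 * x 1, a 4 * x 2, a 5 * x 3, 0,         a 6 * x 0;
     a 2 * x 2, a 5 * x 3, 0,         a 7 * x 0, a 8 * x 1;
     a 3 * x 3, 0,         a 7 * x 0, a 9 * x 1, a 10 * x 2;
     0,         a 6 * x 0, a 8 * x 1, a 10 * x 2, a 11 * x 3]

/-- The Godeaux action `g·x = (ζ·x1, ζ²·x2, ζ³·x3, ζ⁴·x4)` on `ℂ⁴`. -/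
noncomputable def godeaux (ζ : ℂ) (x : Fin 4 → ℂ) : Fin 4 → ℂ :=
  fun i => ζ ^ (i.val + 1) * x i

/-- The quintic determinantal polynomial `x ↦ det M(a,x)` is invariant under the
Godeaux action of `ℤ/5ℤ`. -/
theorem campedelli_det_invariant (ζ : ℂ) (hζ : ζ ^ 5 = 1)
    (a : Fin 12 → ℂ) (x : Fin 4 → ℂ) :
    (CampedelliM a (godeaux ζ x)).det = (CampedelliM a x).det := by
  have h : CampedelliM a (godeaux ζ x) =
      Matrix.diagonal (fun i : Fin 5 => ζ ^ i.val) * CampedelliM a x *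
        Matrix.diagonal (fun i : Fin 5 => ζ ^ (i.val + 1)) := by
    have h6 : ζ ^ 6 = ζ := by linear_combination ζ * hζ
    have h7 : ζ ^ 7 = ζ ^ 2 := by linear_combination ζ ^ 2 * hζ
    have h8 : ζ ^ 8 = ζ ^ 3 := by linear_combination ζ ^ 3 * hζ
    have h9 : ζ ^ 9 = ζ ^ 4 := by linear_combination ζ ^ 4 * hζ
    ext i j
    rw [Matrix.mul_diagonal, Matrix.diagonal_mul]
    fin_cases i <;> fin_cases j <;> simp [CampedelliM, godeaux] <;> ring_nf <;>
      simp only [h6, h7, h8, h9]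
  rw [h, Matrix.det_mul, Matrix.det_mul, Matrix.det_diagonal, Matrix.det_diagonal]
  simp only [Fin.prod_univ_five]
  have h25 : ζ ^ 25 = 1 := by
    rw [show (25 : ℕ) = 5 * 5 from rfl, pow_mul, hζ, one_pow]
  simp
  linear_combination (CampedelliM a x).det * h25
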